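/- Suppose the metric space $X$ satisfies the chain condition with constants $M\ge 1$, $0<m\le 1$ (for a given $\lambda\ge 1$). Let $x\in X$ and $0<R_1<R_2<\mathrm{diam}(X)/4$, and let $B_0,B_1,B_2,\dots$ be a chain associated with $x$ and radius $R_2$. Then from this collection one can find consecutive balls $B_{i_{R_2}},B_{i_{R_2}+1},\dots,B_{i_{R_1}}$ such that $\frac{R_2}{M(1+M)^2}\le\mathrm{diam}(B_{i_{R_2}})\le M R_2$ and $\frac{R_1}{M(1+M)^2}\le\mathrm{diam}(B_{i_{R_1}})\le M R_1$, with $B_{i_{R_2}}\subset B(x,R_2)$ and $B_{i_{R_1}}\subset B(x,R_1)$, and the balls $B_{i_{R_2}},B_{i_{R_2}+1},\dots,B_{i_{R_1}}$ again form a chain (i.e., satisfy properties (2)–(5) of the chain condition and consecutive balls are linked as in property (4)). -/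

import Mathlib

open Metric Set

noncomputable section

variable {X : Type*}

/-- The balls `Bᵢ = B(c i, ρ i)` form a chain associated with `x, r`, with constants
`lam, M, m`, in the sense of the chain condition: (1) `B₀ ⊆ X \ B(x,r)`;
(2) `M⁻¹ diam Bᵢ ≤ dist(x, Bᵢ) ≤ M diam Bᵢ`; (3) `dist(x, Bᵢ) ≤ M r 2^{-m i}`;
(4) there is a ball `Dᵢ ⊆ Bᵢ ∩ Bᵢ₊₁` with `Bᵢ ∪ Bᵢ₊₁ ⊆ M Dᵢ`;
(5) no point of `X` belongs to more than `M` of the balls `lam Bᵢ`. -/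
structure MetricChain [MetricSpace X] (lam M m : ℝ) (x : X) (r : ℝ)
    (c : ℕ → X) (ρ : ℕ → ℝ) : Prop where
  rad_pos : ∀ i, 0 < ρ i
  start : ball (c 0) (ρ 0) ⊆ (ball x r)ᶜ
  dist_diam : ∀ i,
    M⁻¹ * Metric.diam (ball (c i) (ρ i)) ≤ Metric.infDist x (ball (c i) (ρ i)) ∧
      Metric.infDist x (ball (c i) (ρ i)) ≤ M * Metric.diam (ball (c i) (ρ i))
  decay : ∀ i, Metric.infDist x (ball (c i) (ρ i)) ≤ M * r * (2 : ℝ) ^ (-(m * (i : ℝ)))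
  link : ∀ i, ∃ (d : X) (s : ℝ), 0 < s ∧
      ball d s ⊆ ball (c i) (ρ i) ∩ ball (c (i + 1)) (ρ (i + 1)) ∧
      ball (c i) (ρ i) ∪ ball (c (i + 1)) (ρ (i + 1)) ⊆ ball d (M * s)
  overlap : ∀ y : X, ({i : ℕ | y ∈ ball (c i) (lam * ρ i)}).Finite ∧
      (({i : ℕ | y ∈ ball (c i) (lam * ρ i)}).ncard : ℝ) ≤ M

/-- A ball of a chain that meets a ball not contained in `B(x, R)` has diameter bounded below
by a multiple of `R`. -/
theorem le_diam_of_inter_nonempty_of_not_subset [MetricSpace X] {M R : ℝ} (hM : 1 ≤ M) {x : X}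
    {A B : Set X} (hA : Bornology.IsBounded A) (hB : Bornology.IsBounded B)
    (hAd : M⁻¹ * Metric.diam A ≤ Metric.infDist x A)
    (hAD : Metric.infDist x A ≤ M * Metric.diam A)
    (hBD : Metric.infDist x B ≤ M * Metric.diam B)
    (hAB : (A ∩ B).Nonempty) (hAR : ¬ A ⊆ ball x R) :
    R / (M * (1 + M) ^ 2) ≤ Metric.diam B := by
  obtain ⟨z, hzA, hzB⟩ := hAB
  obtain ⟨y, hyA, hy⟩ := Set.not_subset.1 hAR
  have hM0 : 0 < M := by linarith
  have hRy : R ≤ dist x y := by simpa [dist_comm] using hy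
  have hy' := dist_le_infDist_add_diam (x := x) hA hyA
  have hz' := dist_le_infDist_add_diam (x := x) hB hzB
  have hz : Metric.infDist x A ≤ dist x z := infDist_le_dist_of_mem hzA
  have hAd' : Metric.diam A ≤ M * Metric.infDist x A := (inv_mul_le_iff₀ hM0).1 hAd
  have hR : R ≤ (1 + M) * Metric.diam A := by linarith
  have hinf : Metric.infDist x A ≤ (1 + M) * Metric.diam B := by linarith
  rw [div_le_iff₀ (by positivity)]
  calc R ≤ (1 + M) * (M * ((1 + M) * Metric.diam B)) := by
        refine hR.trans ?_
        gcongr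
        exact hAd'.trans (by gcongr)
    _ = Metric.diam B * (M * (1 + M) ^ 2) := by ring

namespace MetricChain

variable [MetricSpace X] {lam M m r : ℝ} {x : X} {c : ℕ → X} {ρ : ℕ → ℝ}

theorem diam_le (h : MetricChain lam M m x r c ρ) (hM : 0 < M) (n : ℕ) :
    Metric.diam (ball (c n) (ρ n)) ≤ M * Metric.infDist x (ball (c n) (ρ n)) :=
  (inv_mul_le_iff₀ hM).1 (h.dist_diam n).1

theorem exists_subset_ball (h : MetricChain lam M m x r c ρ) (hM : 0 < M) (hm : 0 < m)
    {R : ℝ} (hR : 0 < R) : ∃ n, ball (c n) (ρ n) ⊆ ball x R := by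
  have hlim : Filter.Tendsto (fun n : ℕ => (1 + M) * (M * r * (2 : ℝ) ^ (-(m * (n : ℝ)))))
      Filter.atTop (nhds ((1 + M) * (M * r * 0))) := by
    refine ((((tendsto_rpow_atBot_of_base_gt_one 2 one_lt_two).comp
      (Filter.tendsto_neg_atTop_atBot.comp ?_)).const_mul _).const_mul _)
    exact tendsto_natCast_atTop_atTop.const_mul_atTop hm
  rw [mul_zero, mul_zero] at hlim
  obtain ⟨n, hn⟩ := (hlim.eventually_lt_const hR).exists
  refine ⟨n, fun y hy => ?_⟩
  rw [mem_ball']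
  have hy' := dist_le_infDist_add_diam (x := x) isBounded_ball hy
  have hd := h.diam_le hM n
  have hdecay := mul_le_mul_of_nonneg_left (h.decay n) (by linarith : 0 ≤ 1 + M)
  linarith

/-- The first ball of a chain contained in `B(x, R)` has diameter comparable to `R`. -/
theorem diam_bounds_of_first_subset (h : MetricChain lam M m x r c ρ) (hM : 1 ≤ M)
    {R : ℝ} (hRr : R ≤ r) {n : ℕ} (hn : ball (c n) (ρ n) ⊆ ball x R)
    (hmin : ∀ k < n, ¬ ball (c k) (ρ k) ⊆ ball x R) :
    R / (M * (1 + M) ^ 2) ≤ Metric.diam (ball (c n) (ρ n)) ∧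
      Metric.diam (ball (c n) (ρ n)) ≤ M * R := by
  have hc : ∀ k, c k ∈ ball (c k) (ρ k) := fun k => mem_ball_self (h.rad_pos k)
  constructor
  · cases n with
    | zero => exact absurd (ball_subset_ball hRr (hn (hc 0))) (h.start (hc 0))
    | succ k =>
      obtain ⟨d, s, hs, hsub, -⟩ := h.link k
      exact le_diam_of_inter_nonempty_of_not_subset hM isBounded_ball isBounded_ball
        (h.dist_diam k).1 (h.dist_diam k).2 (h.dist_diam (k + 1)).2
        ⟨d, hsub (mem_ball_self hs)⟩ (hmin k k.lt_succ_self)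
  · refine (h.diam_le (by linarith) n).trans ?_
    have hcx : dist x (c n) < R := mem_ball'.1 (hn (hc n))
    gcongr
    exact (infDist_le_dist_of_mem (hc n)).trans hcx.le

end MetricChain

/-- **Lemma 3.2.** Suppose `X` satisfies the chain condition with constants `M ≥ 1`,
`0 < m ≤ 1` (for a given `lam ≥ 1`), let `0 < R₁ < R₂ < diam X / 4` and let
`B₀, B₁, B₂, …` be a chain associated with `x, R₂`. Then one can find consecutive balls
`B_{i_{R₂}}, …, B_{i_{R₁}}` from this collection with
`R₂ / (M(1+M)²) ≤ diam B_{i_{R₂}} ≤ M R₂`, `R₁ / (M(1+M)²) ≤ diam B_{i_{R₁}} ≤ M R₁`,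
`B_{i_{R₂}} ⊆ B(x, R₂)`, `B_{i_{R₁}} ⊆ B(x, R₁)`, and these balls again form a chain
(they satisfy properties (2)–(5) of the chain condition, consecutive balls being linked
as in property (4)). -/
theorem metricChain_trim [MetricSpace X] (lam M m : ℝ) (hlam : 1 ≤ lam) (hM : 1 ≤ M)
    (hm0 : 0 < m) (hm1 : m ≤ 1) (x : X) (R₁ R₂ : ℝ) (hR₁ : 0 < R₁) (hR₁₂ : R₁ < R₂)
    (hR₂ : ENNReal.ofReal R₂ < EMetric.diam (Set.univ : Set X) / 4)
    (c : ℕ → X) (ρ : ℕ → ℝ) (hchain : MetricChain lam M m x R₂ c ρ) :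
    ∃ i j : ℕ, i ≤ j ∧
      (R₂ / (M * (1 + M) ^ 2) ≤ Metric.diam (ball (c i) (ρ i)) ∧
        Metric.diam (ball (c i) (ρ i)) ≤ M * R₂) ∧
      (R₁ / (M * (1 + M) ^ 2) ≤ Metric.diam (ball (c j) (ρ j)) ∧
        Metric.diam (ball (c j) (ρ j)) ≤ M * R₁) ∧
      ball (c i) (ρ i) ⊆ ball x R₂ ∧ ball (c j) (ρ j) ⊆ ball x R₁ ∧
      (∀ n, i ≤ n → n ≤ j →
        M⁻¹ * Metric.diam (ball (c n) (ρ n)) ≤ Metric.infDist x (ball (c n) (ρ n)) ∧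
          Metric.infDist x (ball (c n) (ρ n)) ≤ M * Metric.diam (ball (c n) (ρ n))) ∧
      (∀ n, i ≤ n → n < j → ∃ (d : X) (s : ℝ), 0 < s ∧
        ball d s ⊆ ball (c n) (ρ n) ∩ ball (c (n + 1)) (ρ (n + 1)) ∧
        ball (c n) (ρ n) ∪ ball (c (n + 1)) (ρ (n + 1)) ⊆ ball d (M * s)) ∧
      (∀ y : X,
        (({n : ℕ | i ≤ n ∧ n ≤ j ∧ y ∈ ball (c n) (lam * ρ n)}).ncard : ℝ) ≤ M) := by
  classical
  have hM0 : 0 < M := by linarith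
  have h₁ := hchain.exists_subset_ball hM0 hm0 hR₁
  have h₂ := hchain.exists_subset_ball hM0 hm0 (hR₁.trans hR₁₂)
  refine ⟨Nat.find h₂, Nat.find h₁,
    Nat.find_mono fun n hn => hn.trans (ball_subset_ball hR₁₂.le),
    hchain.diam_bounds_of_first_subset hM le_rfl (Nat.find_spec h₂) fun _ => Nat.find_min h₂,
    hchain.diam_bounds_of_first_subset hM hR₁₂.le (Nat.find_spec h₁) fun _ => Nat.find_min h₁,
    Nat.find_spec h₂, Nat.find_spec h₁, fun n _ _ => hchain.dist_diam n,
    fun n _ _ => hchain.link n, fun y => le_trans ?_ (hchain.overlap y).2⟩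
  exact Nat.cast_le.2 (Set.ncard_le_ncard (fun _ hn => hn.2.2) (hchain.overlap y).1)

end
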